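/- Assume for every x ∈ (0,1) the cell solution X(x) exists and the map (x,y,z) ↦ X(x)(y,z) is C¹ with bounded first derivatives, and let w₀ ∈ C²([0,1]). Define κ^ε(x₁,x₂) := −ε X(x₁)(x₁/ε, x₂/ε) w₀'(x₁). Then ε^{−1} ∫_{R^ε} ( |∇(w₀ + κ^ε)|² + |w₀ + κ^ε|² ) dx₁dx₂ → ∫₀¹ ( r(x) w₀'(x)² + p(x) w₀(x)² ) dx as ε → 0⁺. -/

import Mathlib

open MeasureTheory Set Filter

/-- The thin domain `R^ε = {(x₁,x₂) : x₁ ∈ (0,1), -ε b(x₁) < x₂ < ε G(x₁, x₁/ε)}`. -/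
def thinDomain (b : ℝ → ℝ) (G : ℝ × ℝ → ℝ) (ε : ℝ) : Set (ℝ × ℝ) :=
  {p : ℝ × ℝ | p.1 ∈ Ioo 0 1 ∧ p.2 ∈ Ioo (-(ε * b p.1)) (ε * G (p.1, p.1 / ε))}

/-- The representative cell `Y*(x) = {(y,z) : 0 < y < L, -b(x) < z < G(x,y)}`. -/
def cellDomain (L : ℝ) (b : ℝ → ℝ) (G : ℝ × ℝ → ℝ) (x : ℝ) : Set (ℝ × ℝ) :=
  {q : ℝ × ℝ | q.1 ∈ Ioo 0 L ∧ q.2 ∈ Ioo (-(b x)) (G (x, q.1))}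

/-- `∂_y` of a function of `(x, y, z)`. -/
noncomputable def pdy (X : ℝ × ℝ × ℝ → ℝ) (q : ℝ × ℝ × ℝ) : ℝ := fderiv ℝ X q (0, 1, 0)

/-- `∂_z` of a function of `(x, y, z)`. -/
noncomputable def pdz (X : ℝ × ℝ × ℝ → ℝ) (q : ℝ × ℝ × ℝ) : ℝ := fderiv ℝ X q (0, 0, 1)

/-- The homogenized coefficient `r(x) = (1/L) ∫_{Y*(x)} (1 - ∂_y X(x)(y,z)) dy dz`. -/
noncomputable def rcoef (L : ℝ) (b : ℝ → ℝ) (G : ℝ × ℝ → ℝ) (X : ℝ × ℝ × ℝ → ℝ) (x : ℝ) : ℝ :=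
  (1 / L) * ∫ q in cellDomain L b G x, (1 - pdy X (x, q.1, q.2))

/-- The homogenized coefficient `p(x) = |Y*(x)| / L`. -/
noncomputable def pcoef (L : ℝ) (b : ℝ → ℝ) (G : ℝ × ℝ → ℝ) (x : ℝ) : ℝ :=
  (volume (cellDomain L b G x)).toReal / L

/-- The first-order corrector `κ^ε(x₁,x₂) = -ε X(x₁)(x₁/ε, x₂/ε) w₀'(x₁)`. -/
noncomputable def corrector (X : ℝ × ℝ × ℝ → ℝ) (w₀ : ℝ → ℝ) (ε : ℝ) (p : ℝ × ℝ) : ℝ :=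
  -(ε * X (p.1, p.1 / ε, p.2 / ε) * deriv w₀ p.1)


lemma aux_region (a : ℝ) (ha : 0 ≤ a) (α γ : ℝ → ℝ) (hα : Continuous α) (hγ : Continuous γ)
    (hαγ : ∀ x, α x ≤ γ x) (k : ℝ × ℝ → ℝ) (hk : Continuous k) :
    ∫ p in {p : ℝ × ℝ | p.1 ∈ Ioo 0 a ∧ p.2 ∈ Ioo (α p.1) (γ p.1)}, k p
      = ∫ x in (0:ℝ)..a, ∫ z in (α x)..(γ x), k (x, z) := by
  set S : Set (ℝ × ℝ) := {p : ℝ × ℝ | p.1 ∈ Ioo 0 a ∧ p.2 ∈ Ioo (α p.1) (γ p.1)} with hS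
  have hSm : MeasurableSet S :=
    measurableSet_regionBetween hα.measurable hγ.measurable measurableSet_Ioo
  obtain ⟨A, hA⟩ := (isCompact_Icc (a := (0:ℝ)) (b := a)).bddBelow_image hα.continuousOn
  obtain ⟨B, hB⟩ := (isCompact_Icc (a := (0:ℝ)) (b := a)).bddAbove_image hγ.continuousOn
  have hsub : S ⊆ Icc 0 a ×ˢ Icc A B := by
    rintro ⟨x, z⟩ ⟨hx, hz⟩
    have hx' := Ioo_subset_Icc_self hx
    exact ⟨hx', (hA (mem_image_of_mem _ hx')).trans hz.1.le,
      hz.2.le.trans (hB (mem_image_of_mem _ hx'))⟩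
  have hint : IntegrableOn k S :=
    (hk.continuousOn.integrableOn_compact (isCompact_Icc.prod isCompact_Icc)).mono_set hsub
  rw [← integral_indicator hSm]
  rw [Measure.volume_eq_prod, integral_prod]
  · rw [intervalIntegral.integral_of_le ha, integral_Ioc_eq_integral_Ioo, ← integral_indicator measurableSet_Ioo]
    congr 1
    ext x
    by_cases hx : x ∈ Ioo 0 a
    · rw [indicator_of_mem hx, intervalIntegral.integral_of_le (hαγ x),
        integral_Ioc_eq_integral_Ioo, ← integral_indicator measurableSet_Ioo]
      congr 1
      ext z
      by_cases hz : z ∈ Ioo (α x) (γ x)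
      · rw [indicator_of_mem hz, indicator_of_mem]; exact ⟨hx, hz⟩
      · rw [indicator_of_notMem hz, indicator_of_notMem]; exact fun h => hz h.2
    · rw [indicator_of_notMem hx]
      have : ∀ z, S.indicator k (x, z) = 0 := fun z => indicator_of_notMem (fun h => hx h.1) _
      simp [this]
  · rw [← Measure.volume_eq_prod]
    exact hint.integrable_indicator hSm

lemma aux_paramint {E : Type*} [TopologicalSpace E] [FirstCountableTopology E]
    (a c : E → ℝ) (ha : Continuous a) (hc : Continuous c) (f : E → ℝ → ℝ)
    (hf : Continuous f.uncurry) : Continuous fun x => ∫ t in (a x)..(c x), f x t := by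
  have hi : ∀ x u v, IntervalIntegrable (f x) volume u v := fun x u v =>
    (hf.comp (Continuous.prodMk_right x)).intervalIntegrable u v
  have : (fun x => ∫ t in (a x)..(c x), f x t)
      = fun x => (∫ t in (0:ℝ)..(c x), f x t) - ∫ t in (0:ℝ)..(a x), f x t := by
    ext x
    rw [intervalIntegral.integral_interval_sub_left (hi _ _ _) (hi _ _ _)]
  rw [this]
  exact (intervalIntegral.continuous_parametric_intervalIntegral_of_continuous hf hc).sub
    (intervalIntegral.continuous_parametric_intervalIntegral_of_continuous hf ha)

lemma aux_flux (L α : ℝ) (hL : 0 < L) (γ : ℝ → ℝ) (hγ : ContDiff ℝ 1 γ) (hαγ : ∀ y, α < γ y)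
    (hγL : γ L = γ 0) (F₁ F₂ g : ℝ × ℝ → ℝ) (h1 : Continuous F₁) (h2 : Continuous F₂)
    (hg : Continuous g)
    (hd : ∀ y ∈ Ioo 0 L, ∀ z ∈ Ioo α (γ y), DifferentiableAt ℝ F₁ (y, z) ∧
      DifferentiableAt ℝ F₂ (y, z) ∧ fderiv ℝ F₁ (y, z) (1, 0) + fderiv ℝ F₂ (y, z) (0, 1) = g (y, z))
    (htop : ∀ y, F₂ (y, γ y) - deriv γ y * F₁ (y, γ y) = 0)
    (hbot : ∀ y, F₂ (y, α) = 0) (hper : ∀ z, F₁ (L, z) = F₁ (0, z)) :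
    ∫ y in (0:ℝ)..L, ∫ z in α..(γ y), g (y, z) = 0 := by
  let D : ℝ → ℝ → ℝ := fun y z => (∫ t in α..z, g (y, t)) - F₂ (y, z)
  let Ψ : ℝ → ℝ → ℝ := fun y z => ∫ t in α..z, F₁ (y, t)
  have hγc : Continuous γ := hγ.continuous
  have hDc : Continuous (fun q : ℝ × ℝ => D q.1 q.2) := by
    refine Continuous.sub ?_ (by fun_prop)
    exact aux_paramint (fun _ : ℝ × ℝ => α) (fun q => q.2) (by fun_prop) (by fun_prop)
      (fun q t => g (q.1, t)) (by simp only [Function.uncurry_def]; fun_prop)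
  have hΨc : Continuous (fun q : ℝ × ℝ => Ψ q.1 q.2) :=
    aux_paramint (fun _ : ℝ × ℝ => α) (fun q => q.2) (by fun_prop) (by fun_prop)
      (fun q t => F₁ (q.1, t)) (by
      simp only [Function.uncurry_def]; fun_prop)
  -- open domain
  let Ω : Set (ℝ × ℝ) := {q | q.1 ∈ Ioo 0 L ∧ q.2 ∈ Ioo α (γ q.1)}
  have hΩ : IsOpen Ω := by
    have : Ω = {q : ℝ × ℝ | 0 < q.1} ∩ {q | q.1 < L} ∩ ({q | α < q.2} ∩ {q | q.2 < γ q.1}) := by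
      ext q; rfl
    rw [this]
    exact ((isOpen_lt (by fun_prop) (by fun_prop)).inter (isOpen_lt (by fun_prop) (by fun_prop))).inter
      ((isOpen_lt (by fun_prop) (by fun_prop)).inter (isOpen_lt (by fun_prop) (by fun_prop)))
  have hpy : ∀ q ∈ Ω, HasDerivAt (fun y => Ψ y q.2) (D q.1 q.2) q.1 := by
    rintro ⟨y₀, z⟩ ⟨hy₀, hz⟩
    simp only at hy₀ hz ⊢
    have hev : ∀ᶠ y in nhds y₀, y ∈ Ioo 0 L ∧ z < γ y :=
      Filter.Eventually.and (Ioo_mem_nhds hy₀.1 hy₀.2) (hγc.continuousAt.eventually (lt_mem_nhds hz.2))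
    obtain ⟨δ, hδ, hball⟩ := Metric.eventually_nhds_iff_ball.1 hev
    have key : ∀ y ∈ Metric.ball y₀ δ, Ψ y z = Ψ y₀ z + ∫ t in y₀..y, D t z := by
      intro y hy
      have hrect : ∀ q ∈ Ioo (min y₀ y) (max y₀ y) ×ˢ Ioo (min α z) (max α z), q ∈ Ω := by
        rintro ⟨s, t⟩ ⟨hs, ht⟩
        rw [min_eq_left hz.1.le, max_eq_right hz.1.le] at ht
        have hs' : s ∈ Metric.ball y₀ δ := by
          have hc : Convex ℝ (Metric.ball y₀ δ) := convex_ball _ _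
          have := hc.ordConnected.uIcc_subset (Metric.mem_ball_self hδ) hy
          exact this ⟨hs.1.le, hs.2.le⟩
        obtain ⟨hs1, hs2⟩ := hball s hs'
        exact ⟨hs1, ht.1, ht.2.trans hs2⟩
      let f' : ℝ × ℝ → ℝ × ℝ →L[ℝ] ℝ := fun q => fderiv ℝ F₁ q
      let g' : ℝ × ℝ → ℝ × ℝ →L[ℝ] ℝ := fun q => fderiv ℝ F₂ q +
        (g q - (fderiv ℝ F₁ q (1, 0) + fderiv ℝ F₂ q (0, 1))) • ContinuousLinearMap.snd ℝ ℝ ℝ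
      have hfg : ∀ q, f' q (1, 0) + g' q (0, 1) = g q := by
        intro q
        simp only [f', g', _root_.add_apply, _root_.smul_apply,
          ContinuousLinearMap.coe_snd', smul_eq_mul]
        ring
      have := integral2_divergence_prod_of_hasFDerivAt_off_countable F₁ F₂ f' g' y₀ α y z ∅
        countable_empty h1.continuousOn h2.continuousOn
        (by
          intro q hq
          obtain ⟨hq1, hq2⟩ := hrect q hq.1
          exact (hd q.1 hq1 q.2 hq2).1.hasFDerivAt)
        (by
          intro q hq
          obtain ⟨hq1, hq2⟩ := hrect q hq.1
          obtain ⟨_, e2, e3⟩ := hd q.1 hq1 q.2 hq2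
          have e4 : g' q = fderiv ℝ F₂ q := by
            simp only [g']
            rw [e3, sub_self, zero_smul, add_zero]
          rw [e4]
          exact e2.hasFDerivAt)
        (by
          simp only [hfg]
          exact hg.continuousOn.integrableOn_compact (isCompact_uIcc.prod isCompact_uIcc))
      simp only [hfg, hbot, intervalIntegral.integral_zero, sub_zero] at this
      simp only [Ψ, D]
      rw [intervalIntegral.integral_sub, this]
      · ring
      · apply Continuous.intervalIntegrable
        exact aux_paramint (fun _ : ℝ => α) (fun _ => z) (by fun_prop) (by fun_prop)
          (fun q t => g (q, t)) (by
          simp only [Function.uncurry_def]; fun_prop)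
      · apply Continuous.intervalIntegrable; fun_prop
    have hDz : Continuous fun t => D t z := hDc.comp (Continuous.prodMk_left z)
    have hder : HasDerivAt (fun y => Ψ y₀ z + ∫ t in y₀..y, D t z) (D y₀ z) y₀ :=
      (intervalIntegral.integral_hasDerivAt_right (hDz.intervalIntegrable _ _)
        (hDz.stronglyMeasurableAtFilter _ _) hDz.continuousAt).const_add _
    refine hder.congr_of_eventuallyEq ?_
    filter_upwards [Metric.ball_mem_nhds y₀ hδ] with y hy using key y hy
  have hpz : ∀ q : ℝ × ℝ, HasDerivAt (fun z => Ψ q.1 z) (F₁ (q.1, q.2)) q.2 := by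
    intro q
    have hc : Continuous fun t => F₁ (q.1, t) := by fun_prop
    exact intervalIntegral.integral_hasDerivAt_right (hc.intervalIntegrable _ _)
        (hc.stronglyMeasurableAtFilter _ _) hc.continuousAt
  have hΨd : ∀ q ∈ Ω, HasFDerivAt (fun q : ℝ × ℝ => Ψ q.1 q.2)
      ((ContinuousLinearMap.toSpanSingleton ℝ (D q.1 q.2)).coprod
        (ContinuousLinearMap.toSpanSingleton ℝ (F₁ (q.1, q.2)))) q := by
    intro q hq
    have := hasStrictFDerivAt_uncurry_coprod (𝕜 := ℝ) (u := q) (f := Ψ)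
      (f₁ := fun y z => ContinuousLinearMap.toSpanSingleton ℝ (D y z))
      (f₂ := fun y z => ContinuousLinearMap.toSpanSingleton ℝ (F₁ (y, z)))
      (by filter_upwards [hΩ.mem_nhds hq] with v hv using (hpy v hv).hasFDerivAt)
      (by filter_upwards with v using (hpz v).hasFDerivAt)
      (by
        apply Continuous.continuousAt
        exact (ContinuousLinearMap.toSpanSingletonCLE (𝕜 := ℝ) (E := ℝ)).continuous.comp hDc)
      (by
        apply Continuous.continuousAt
        exact (ContinuousLinearMap.toSpanSingletonCLE (𝕜 := ℝ) (E := ℝ)).continuous.comp h1)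
    exact this.hasFDerivAt
  -- the family of curves
  let ζ : ℝ → ℝ → ℝ := fun s y => α + s * (γ y - α)
  have hγ' : Continuous (deriv γ) := hγ.continuous_deriv le_rfl
  have hζc : Continuous (fun q : ℝ × ℝ => ζ q.1 q.2) := by simp only [ζ]; fun_prop
  let I : ℝ → ℝ → ℝ := fun s y => D y (ζ s y) + s * deriv γ y * F₁ (y, ζ s y)
  have hIc : Continuous (Function.uncurry I) := by
    simp only [Function.uncurry_def, I]
    have : Continuous fun x : ℝ × ℝ => D x.2 (ζ x.1 x.2) :=
      hDc.comp (continuous_snd.prodMk hζc)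
    fun_prop
  have hK : ∀ s ∈ Ioo (0:ℝ) 1, ∫ y in (0:ℝ)..L, I s y = 0 := by
    intro s hs
    have hζs : Continuous (ζ s) := hζc.comp (Continuous.prodMk_right s)
    have := intervalIntegral.integral_eq_sub_of_hasDerivAt_of_le (f := fun y => Ψ y (ζ s y))
      (f' := I s) hL.le (hΨc.comp (continuous_id.prodMk hζs)).continuousOn
      (by
        intro y hy
        have hmem : (y, ζ s y) ∈ Ω := by
          refine ⟨hy, ?_, ?_⟩ <;> simp only [ζ] <;> nlinarith [hαγ y, hs.1, hs.2]
        have hζd : HasDerivAt (ζ s) (s * deriv γ y) y :=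
          (((hγ.differentiable one_ne_zero y).hasDerivAt.sub_const α).const_mul s).const_add α
        have := (hΨd _ hmem).comp_hasDerivAt y ((hasDerivAt_id y).prodMk hζd)
        have e : I s y = ((ContinuousLinearMap.toSpanSingleton ℝ (D y (ζ s y))).coprod
            (ContinuousLinearMap.toSpanSingleton ℝ (F₁ (y, ζ s y)))) (1, s * deriv γ y) := by
          simp [I]
        rw [e]
        exact this)
      ((hIc.comp (Continuous.prodMk_right s)).intervalIntegrable _ _)
    rw [this]
    simp only [Ψ, ζ, hper, hγL, sub_self]
  have hKc : Continuous fun s => ∫ y in (0:ℝ)..L, I s y :=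
    intervalIntegral.continuous_parametric_intervalIntegral_of_continuous' hIc 0 L
  have hK1 : ∫ y in (0:ℝ)..L, I 1 y = 0 := by
    have hcl : IsClosed {s | ∫ y in (0:ℝ)..L, I s y = 0} := isClosed_eq hKc continuous_const
    have : closure (Ioo (0:ℝ) 1) ⊆ {s | ∫ y in (0:ℝ)..L, I s y = 0} :=
      hcl.closure_subset_iff.2 hK
    rw [closure_Ioo (by norm_num)] at this
    exact this (right_mem_Icc.2 zero_le_one)
  rw [← hK1]
  congr 1
  ext y
  have := htop y
  simp only [I, D, ζ, one_mul, add_sub_cancel]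
  linarith

lemma aux_avg (L : ℝ) (hL : 0 < L) (Q : ℝ → ℝ → ℝ) (hQ : Continuous (Function.uncurry Q))
    (hper : ∀ x y, Q x (y + L) = Q x y) :
    Tendsto (fun ε : ℝ => ∫ x in (0:ℝ)..1, Q x (x / ε)) (nhdsWithin 0 (Ioi 0))
      (nhds (∫ x in (0:ℝ)..1, (1 / L) * ∫ y in (0:ℝ)..L, Q x y)) := by
  have hcomp : IsCompact (Icc (0:ℝ) 2 ×ˢ Icc (0:ℝ) L) := isCompact_Icc.prod isCompact_Icc
  have hred : ∀ y, ∃ y' ∈ Icc (0:ℝ) L, ∀ x, Q x y = Q x y' := by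
    intro y
    have hp : Function.Periodic (fun y x => Q x y) L := fun y => funext fun x => hper x y
    obtain ⟨y', hy', h⟩ := hp.exists_mem_Ico₀ hL y
    exact ⟨y', Ico_subset_Icc_self hy', fun x => congrFun h x⟩
  obtain ⟨M, hM⟩ := hcomp.exists_bound_of_continuousOn hQ.continuousOn
  have hM' : ∀ x ∈ Icc (0:ℝ) 2, ∀ y, |Q x y| ≤ M := by
    intro x hx y
    obtain ⟨y', hy', h⟩ := hred y
    rw [h]
    exact hM (x, y') ⟨hx, hy'⟩
  have hM0 : 0 ≤ M := (abs_nonneg _).trans (hM' 0 (by norm_num) 0)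
  have huc := hcomp.uniformContinuousOn_of_continuous hQ.continuousOn
  rw [Metric.uniformContinuousOn_iff] at huc
  have hc2 : ∀ ε : ℝ, ∀ s t : ℝ, Continuous fun x => Q (x + s) (x / ε + t) := fun ε s t =>
    hQ.comp ((by fun_prop : Continuous fun x : ℝ => (x + s, x / ε + t)))
  rw [Metric.tendsto_nhdsWithin_nhds]
  intro η hη
  obtain ⟨δ, hδ, hδ'⟩ := huc (η / 4) (by positivity)
  refine ⟨min (min (1 / L) (δ / L)) (η / (8 * L * (M + 1))), by positivity, ?_⟩
  intro ε hε hεd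
  have hε : 0 < ε := hε
  rw [Real.dist_eq, sub_zero, abs_of_pos hε, lt_min_iff, lt_min_iff, lt_div_iff₀ hL, lt_div_iff₀ hL,
    lt_div_iff₀ (by positivity)] at hεd
  obtain ⟨⟨hε1, hε2⟩, hε3⟩ := hεd
  have hI : ∫ x in (0:ℝ)..1, (1 / L) * ∫ y in (0:ℝ)..L, Q x y
      = (1 / L) * ∫ t in (0:ℝ)..L, ∫ x in (0:ℝ)..1, Q x (x / ε + t) := by
    rw [intervalIntegral.integral_const_mul]
    congr 1
    rw [intervalIntegral_intervalIntegral_swap (F := fun t x => Q x (x / ε + t))]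
    · congr 1
      ext x
      have hp : Function.Periodic (Q x) L := hper x
      have := hp.intervalIntegral_add_eq 0 (x / ε)
      rw [zero_add] at this
      rw [this]
      rw [intervalIntegral.integral_comp_add_left (fun y => Q x y)]
      simp
    · refine IntegrableOn.mono_set (t := uIcc 0 L ×ˢ uIcc 0 1) ?_
        (prod_mono uIoc_subset_uIcc uIoc_subset_uIcc)
      refine ContinuousOn.integrableOn_compact (isCompact_uIcc.prod isCompact_uIcc) ?_
      apply Continuous.continuousOn
      simp only [Function.uncurry_def]
      exact hQ.comp (by fun_prop : Continuous fun p : ℝ × ℝ => (p.2, p.2 / ε + p.1))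
  have hJ : ∫ x in (0:ℝ)..1, Q x (x / ε)
      = (1 / L) * ∫ t in (0:ℝ)..L, ∫ x in (0:ℝ)..1, Q x (x / ε) := by
    rw [intervalIntegral.integral_const]
    simp [hL.ne']
  have hc1 : Continuous fun x => Q x (x / ε) := by simpa using hc2 ε 0 0
  have hc3 : ∀ t, Continuous fun x => Q x (x / ε + t) := fun t => by simpa using hc2 ε 0 t
  have key : ∀ t ∈ Icc (0:ℝ) L,
      |(∫ x in (0:ℝ)..1, Q x (x / ε)) - ∫ x in (0:ℝ)..1, Q x (x / ε + t)| ≤ η / 2 := by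
    intro t ht
    have hs0 : 0 ≤ ε * t := mul_nonneg hε.le ht.1
    have hsL : ε * t ≤ ε * L := mul_le_mul_of_nonneg_left ht.2 hε.le
    have e1 : ∫ x in (0:ℝ)..1, Q (x + ε * t) (x / ε + t)
        = ∫ u in (ε * t)..(1 + ε * t), Q u (u / ε) := by
      have := intervalIntegral.integral_comp_add_right (a := 0) (b := 1)
        (fun u => Q u (u / ε)) (ε * t)
      rw [zero_add] at this
      rw [← this]
      congr 1
      ext x
      congr 1
      field_simp
    have hii : ∀ a b : ℝ, IntervalIntegrable (fun u => Q u (u / ε)) volume a b :=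
      fun a b => hc1.intervalIntegrable a b
    have e2 : (∫ x in (0:ℝ)..1, Q x (x / ε)) - ∫ u in (ε * t)..(1 + ε * t), Q u (u / ε)
        = (∫ x in (0:ℝ)..(ε * t), Q x (x / ε)) - ∫ x in (1:ℝ)..(1 + ε * t), Q x (x / ε) :=
      intervalIntegral.integral_interval_sub_interval_comm (hii _ _) (hii _ _) (hii _ _)
    have b1 : |∫ x in (0:ℝ)..(ε * t), Q x (x / ε)| ≤ M * (ε * L) := by
      have := intervalIntegral.norm_integral_le_of_norm_le_const (a := 0) (b := ε * t) (C := M)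
        (f := fun x => Q x (x / ε)) (by
          intro x hx
          rw [uIoc_of_le hs0] at hx
          exact hM' x ⟨hx.1.le, by linarith [hx.2]⟩ _)
      rw [sub_zero, abs_of_nonneg hs0] at this
      exact this.trans (mul_le_mul_of_nonneg_left hsL hM0)
    have b2 : |∫ x in (1:ℝ)..(1 + ε * t), Q x (x / ε)| ≤ M * (ε * L) := by
      have := intervalIntegral.norm_integral_le_of_norm_le_const (a := 1) (b := 1 + ε * t) (C := M)
        (f := fun x => Q x (x / ε)) (by
          intro x hx
          rw [uIoc_of_le (by linarith)] at hx
          exact hM' x ⟨by linarith [hx.1], by linarith [hx.2]⟩ _)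
      rw [add_sub_cancel_left, abs_of_nonneg hs0] at this
      exact this.trans (mul_le_mul_of_nonneg_left hsL hM0)
    have b3 : |∫ x in (0:ℝ)..1, (Q (x + ε * t) (x / ε + t) - Q x (x / ε + t))| ≤ η / 4 := by
      have := intervalIntegral.norm_integral_le_of_norm_le_const (a := 0) (b := 1) (C := η / 4)
        (f := fun x => Q (x + ε * t) (x / ε + t) - Q x (x / ε + t)) (by
          intro x hx
          rw [uIoc_of_le zero_le_one] at hx
          obtain ⟨y', hy', h⟩ := hred (x / ε + t)
          simp only [h]
          refine (hδ' (x + ε * t, y') ⟨⟨by linarith [hx.1], by linarith [hx.2]⟩, hy'⟩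
            (x, y') ⟨⟨hx.1.le, by linarith [hx.2]⟩, hy'⟩ ?_).le
          rw [Prod.dist_eq]
          simp only [Real.dist_eq, sub_self, abs_zero, add_sub_cancel_left, abs_of_nonneg hs0]
          exact max_lt (by linarith) hδ)
      simpa using this
    rw [intervalIntegral.integral_sub ((hc2 ε _ _).intervalIntegrable _ _)
      ((hc3 t).intervalIntegrable _ _), e1] at b3
    have : M * (ε * L) ≤ η / 8 := by nlinarith [mul_pos hε hL]
    rw [abs_le] at *
    constructor <;> linarith [b1.1, b1.2, b2.1, b2.2, b3.1, b3.2]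
  rw [Real.dist_eq, hI, hJ, ← mul_sub, ← intervalIntegral.integral_sub]
  · rw [abs_mul, abs_of_pos (by positivity : 0 < 1 / L)]
    have := intervalIntegral.norm_integral_le_of_norm_le_const (a := 0) (b := L) (C := η / 2)
        (f := fun t => (∫ x in (0:ℝ)..1, Q x (x / ε)) - ∫ x in (0:ℝ)..1, Q x (x / ε + t)) (by
          intro t ht
          rw [uIoc_of_le hL.le] at ht
          exact key t (Ioc_subset_Icc_self ht))
    rw [sub_zero, abs_of_pos hL, Real.norm_eq_abs] at this
    calc _ ≤ 1 / L * (η / 2 * L) := mul_le_mul_of_nonneg_left this (by positivity)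
      _ = η / 2 := by field_simp
      _ < η := by linarith
  · exact intervalIntegrable_const
  · apply Continuous.intervalIntegrable
    refine intervalIntegral.continuous_parametric_intervalIntegral_of_continuous'
      (f := fun t x => Q x (x / ε + t)) ?_ 0 1
    simp only [Function.uncurry_def]
    exact hQ.comp (by fun_prop : Continuous fun p : ℝ × ℝ => (p.2, p.2 / ε + p.1))

lemma aux_hom (L : ℝ) (hL : 0 < L) (β : ℝ → ℝ) (hβ : Continuous β) (Γ : ℝ × ℝ → ℝ)
    (hΓ : Continuous Γ) (hΓp : ∀ x y, Γ (x, y + L) = Γ (x, y)) (h : ℝ × ℝ × ℝ → ℝ)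
    (hh : Continuous h) (hp : ∀ x y z, h (x, y + L, z) = h (x, y, z)) :
    Tendsto (fun ε : ℝ => ∫ x in (0:ℝ)..1, ∫ z in (-(β x))..(Γ (x, x / ε)), h (x, x / ε, z))
      (nhdsWithin 0 (Ioi 0))
      (nhds (∫ x in (0:ℝ)..1, (1 / L) * ∫ y in (0:ℝ)..L, ∫ z in (-(β x))..(Γ (x, y)),
        h (x, y, z))) := by
  refine aux_avg L hL (fun x y => ∫ z in (-(β x))..(Γ (x, y)), h (x, y, z)) ?_ ?_
  · simp only [Function.uncurry_def]
    exact aux_paramint (fun q : ℝ × ℝ => -(β q.1)) (fun q => Γ (q.1, q.2)) (by fun_prop)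
      (by fun_prop) (fun q t => h (q.1, q.2, t)) (by
      simp only [Function.uncurry_def]; fun_prop)
  · intro x y
    simp only [hΓp, hp]
lemma aux_fper (L : ℝ) (X : ℝ × ℝ × ℝ → ℝ) (hXC1 : ContDiff ℝ 1 X)
    (hXper : ∀ x ∈ Ioo (0 : ℝ) 1, ∀ y z : ℝ, X (x, y + L, z) = X (x, y, z)) :
    ∀ x ∈ Icc (0:ℝ) 1, ∀ y z, X (x, y + L, z) = X (x, y, z) ∧
      fderiv ℝ X (x, y + L, z) = fderiv ℝ X (x, y, z) := by
  have hX : Continuous X := hXC1.continuous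
  have hX' : Continuous (fderiv ℝ X) := hXC1.continuous_fderiv one_ne_zero
  intro x hx y z
  have hcl : IsClosed {x : ℝ | X (x, y + L, z) = X (x, y, z) ∧
      fderiv ℝ X (x, y + L, z) = fderiv ℝ X (x, y, z)} :=
    (isClosed_eq (by fun_prop) (by fun_prop)).inter (isClosed_eq (by fun_prop) (by fun_prop))
  have hsub : Ioo (0:ℝ) 1 ⊆ {x : ℝ | X (x, y + L, z) = X (x, y, z) ∧
      fderiv ℝ X (x, y + L, z) = fderiv ℝ X (x, y, z)} := by
    intro x hx
    refine ⟨hXper x hx y z, ?_⟩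
    have e1 : fderiv ℝ (fun q => X (q + (0, L, 0))) (x, y, z) = fderiv ℝ X (x, y + L, z) := by
      rw [fderiv_comp_add_right]
      simp
    rw [← e1]
    apply Filter.EventuallyEq.fderiv_eq
    have : ∀ᶠ q : ℝ × ℝ × ℝ in nhds (x, y, z), q.1 ∈ Ioo (0:ℝ) 1 :=
      continuous_fst.continuousAt.eventually (Ioo_mem_nhds hx.1 hx.2)
    filter_upwards [this] with q hq
    have := hXper q.1 hq q.2.1 q.2.2
    rw [← this]
    congr 1
    ext <;> simp
  have := hcl.closure_subset_iff.2 hsub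
  rw [closure_Ioo (by norm_num)] at this
  exact this hx

lemma aux_energy (L : ℝ) (hL : 0 < L) (b : ℝ → ℝ) (G : ℝ × ℝ → ℝ)
    (hGC1 : ContDiffOn ℝ 1 G (Ioo 0 1 ×ˢ (univ : Set ℝ)))
    (hGper : ∀ x y : ℝ, G (x, y + L) = G (x, y))
    (X : ℝ × ℝ × ℝ → ℝ) (hXC1 : ContDiff ℝ 1 X)
    (hXper : ∀ x ∈ Ioo (0 : ℝ) 1, ∀ y z : ℝ, X (x, y + L, z) = X (x, y, z))
    (x : ℝ) (hx : x ∈ Ioo (0:ℝ) 1) (hbG : ∀ y, -(b x) < G (x, y))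
    (hXharm : ∀ q ∈ cellDomain L b G x,
      DifferentiableAt ℝ (pdy X) (x, q.1, q.2) ∧ DifferentiableAt ℝ (pdz X) (x, q.1, q.2) ∧
      fderiv ℝ (pdy X) (x, q.1, q.2) (0, 1, 0) + fderiv ℝ (pdz X) (x, q.1, q.2) (0, 0, 1) = 0)
    (hXupper : ∀ y : ℝ,
      pdz X (x, y, G (x, y)) - fderiv ℝ G (x, y) (0, 1) * pdy X (x, y, G (x, y))
        = -(fderiv ℝ G (x, y) (0, 1)))
    (hXlower : ∀ y : ℝ, pdz X (x, y, -(b x)) = 0) :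
    ∫ y in (0:ℝ)..L, ∫ z in (-(b x))..(G (x, y)),
        ((1 - pdy X (x, y, z)) ^ 2 + pdz X (x, y, z) ^ 2)
      = ∫ y in (0:ℝ)..L, ∫ z in (-(b x))..(G (x, y)), (1 - pdy X (x, y, z)) := by
  have hX : Continuous X := hXC1.continuous
  have hX' : Continuous (fderiv ℝ X) := hXC1.continuous_fderiv one_ne_zero
  have hy : Continuous (pdy X) := by unfold pdy; fun_prop
  have hz : Continuous (pdz X) := by unfold pdz; fun_prop
  have hGat : ∀ y, ContDiffAt ℝ 1 G (x, y) := fun y =>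
    hGC1.contDiffAt ((isOpen_Ioo.prod isOpen_univ).mem_nhds ⟨hx, mem_univ _⟩)
  have hγ : ContDiff ℝ 1 (fun y => G (x, y)) := by
    rw [contDiff_iff_contDiffAt]
    intro y
    exact (hGat y).comp y (contDiffAt_const.prodMk contDiffAt_id)
  have hγd : ∀ y, deriv (fun y => G (x, y)) y = fderiv ℝ G (x, y) (0, 1) := by
    intro y
    have h1 : HasFDerivAt G (fderiv ℝ G (x, y)) (x, y) :=
      ((hGat y).differentiableAt one_ne_zero).hasFDerivAt
    have := h1.comp_hasDerivAt y ((hasDerivAt_const y x).prodMk (hasDerivAt_id y))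
    exact this.deriv
  have hfp := aux_fper L X hXC1 hXper x (Ioo_subset_Icc_self hx)
  have hι : ∀ q : ℝ × ℝ, HasFDerivAt (fun q : ℝ × ℝ => ((x, q.1, q.2) : ℝ × ℝ × ℝ))
      (ContinuousLinearMap.inr ℝ ℝ (ℝ × ℝ)) q := by
    intro q
    exact (hasFDerivAt_const x q).prodMk (hasFDerivAt_id q)
  have hflux := aux_flux L (-(b x)) hL (fun y => G (x, y)) hγ hbG
    (by simpa using hGper x 0)
    (fun q => X (x, q.1, q.2) * (pdy X (x, q.1, q.2) - 1))
    (fun q => X (x, q.1, q.2) * pdz X (x, q.1, q.2))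
    (fun q => pdy X (x, q.1, q.2) ^ 2 + pdz X (x, q.1, q.2) ^ 2 - pdy X (x, q.1, q.2))
    (by fun_prop) (by fun_prop) (by fun_prop)
    (by
      intro y hy z hz
      obtain ⟨d1, d2, d3⟩ := hXharm (y, z) ⟨hy, hz⟩
      simp only at d1 d2 d3
      have hXd : HasFDerivAt X (fderiv ℝ X (x, y, z)) (x, y, z) :=
        (hXC1.differentiable one_ne_zero _).hasFDerivAt
      have k1 := (hXd.mul (d1.hasFDerivAt.sub_const 1)).comp (y, z) (hι (y, z))
      have k2 := (hXd.mul d2.hasFDerivAt).comp (y, z) (hι (y, z))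
      have k1' : HasFDerivAt (fun q : ℝ × ℝ => X (x, q.1, q.2) * (pdy X (x, q.1, q.2) - 1)) _
        (y, z) := k1
      have k2' : HasFDerivAt (fun q : ℝ × ℝ => X (x, q.1, q.2) * pdz X (x, q.1, q.2)) _
        (y, z) := k2
      refine ⟨k1'.differentiableAt, k2'.differentiableAt, ?_⟩
      rw [k1'.fderiv, k2'.fderiv]
      simp only [ContinuousLinearMap.comp_apply, ContinuousLinearMap.inr_apply, _root_.add_apply,
        _root_.smul_apply, smul_eq_mul]
      have e1 : fderiv ℝ X (x, y, z) (0, 1, 0) = pdy X (x, y, z) := rfl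
      have e2 : fderiv ℝ X (x, y, z) (0, 0, 1) = pdz X (x, y, z) := rfl
      rw [e1, e2]
      linear_combination X (x, y, z) * d3)
    (by
      intro y
      simp only [hγd]
      linear_combination X (x, y, G (x, y)) * hXupper y)
    (by intro y; simp [hXlower y])
    (by
      intro z
      have h1 := hfp 0 z
      rw [zero_add] at h1
      simp only [pdy, h1])
  have hii : ∀ (f : ℝ × ℝ → ℝ), Continuous f → Continuous fun y => ∫ z in (-(b x))..(G (x, y)), f (y, z) := by
    intro f hf
    exact aux_paramint (fun _ : ℝ => -(b x)) (fun y => G (x, y)) (by fun_prop) hγ.continuous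
      (fun y z => f (y, z)) (by simp only [Function.uncurry_def]; fun_prop)
  have hc1 : Continuous (fun q : ℝ × ℝ => pdy X (x, q.1, q.2) ^ 2 + pdz X (x, q.1, q.2) ^ 2
      - pdy X (x, q.1, q.2)) := by fun_prop
  have hc2 : Continuous (fun q : ℝ × ℝ => 1 - pdy X (x, q.1, q.2)) := by fun_prop
  rw [← sub_eq_zero, ← hflux, ← intervalIntegral.integral_sub]
  · congr 1
    ext y
    rw [← intervalIntegral.integral_sub]
    · congr 1
      ext z
      ring
    · apply Continuous.intervalIntegrable; fun_prop
    · apply Continuous.intervalIntegrable; fun_prop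
  · exact (hii (fun q : ℝ × ℝ => (1 - pdy X (x, q.1, q.2)) ^ 2 + pdz X (x, q.1, q.2) ^ 2)
      (by fun_prop)).intervalIntegrable _ _
  · exact (hii _ hc2).intervalIntegrable _ _

lemma aux_grad (X : ℝ × ℝ × ℝ → ℝ) (hXC1 : ContDiff ℝ 1 X) (w₀ : ℝ → ℝ) (ε : ℝ) (hε : 0 < ε)
    (p : ℝ × ℝ) (w1 w2 : ℝ) (h1 : HasDerivAt w₀ w1 p.1) (h2 : HasDerivAt (deriv w₀) w2 p.1) :
    fderiv ℝ (fun q : ℝ × ℝ => w₀ q.1 + corrector X w₀ ε q) p (1, 0)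
      = w1 * (1 - pdy X (p.1, p.1 / ε, p.2 / ε))
        - ε * (fderiv ℝ X (p.1, p.1 / ε, p.2 / ε) (1, 0, 0) * w1
          + X (p.1, p.1 / ε, p.2 / ε) * w2) ∧
    fderiv ℝ (fun q : ℝ × ℝ => w₀ q.1 + corrector X w₀ ε q) p (0, 1)
      = - (pdz X (p.1, p.1 / ε, p.2 / ε) * w1) := by
  have hXd : HasFDerivAt X (fderiv ℝ X (p.1, p.1 / ε, p.2 / ε)) (p.1, p.1 / ε, p.2 / ε) :=
    (hXC1.differentiable one_ne_zero _).hasFDerivAt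
  have hf : HasFDerivAt (fun q : ℝ × ℝ => q.1) (ContinuousLinearMap.fst ℝ ℝ ℝ) p := hasFDerivAt_fst
  have hs : HasFDerivAt (fun q : ℝ × ℝ => q.2) (ContinuousLinearMap.snd ℝ ℝ ℝ) p := hasFDerivAt_snd
  have hι : HasFDerivAt (fun q : ℝ × ℝ => ((q.1, q.1 / ε, q.2 / ε) : ℝ × ℝ × ℝ))
      ((ContinuousLinearMap.fst ℝ ℝ ℝ).prod ((ε⁻¹ • ContinuousLinearMap.fst ℝ ℝ ℝ).prod
        (ε⁻¹ • ContinuousLinearMap.snd ℝ ℝ ℝ))) p := by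
    simp only [div_eq_inv_mul]
    exact hf.prodMk ((hf.const_mul ε⁻¹).prodMk (hs.const_mul ε⁻¹))
  have hXι : HasFDerivAt (fun q : ℝ × ℝ => X (q.1, q.1 / ε, q.2 / ε)) _ p :=
    HasFDerivAt.comp p hXd hι
  have hw : HasFDerivAt (fun q : ℝ × ℝ => w₀ q.1) _ p := h1.comp_hasFDerivAt p hf
  have hw' : HasFDerivAt (fun q : ℝ × ℝ => deriv w₀ q.1) _ p := h2.comp_hasFDerivAt p hf
  have htot : HasFDerivAt (fun q : ℝ × ℝ => w₀ q.1 + corrector X w₀ ε q) _ p :=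
    hw.add (((hXι.const_mul ε).mul hw').neg)
  have hd1 : deriv w₀ p.1 = w1 := h1.deriv
  have l1 : fderiv ℝ X (p.1, p.1 / ε, p.2 / ε) (1, ε⁻¹, 0)
      = fderiv ℝ X (p.1, p.1 / ε, p.2 / ε) (1, 0, 0)
        + ε⁻¹ * pdy X (p.1, p.1 / ε, p.2 / ε) := by
    rw [pdy, ← smul_eq_mul, ← map_smul, ← map_add]
    simp
  have l2 : fderiv ℝ X (p.1, p.1 / ε, p.2 / ε) (0, 0, ε⁻¹)
      = ε⁻¹ * pdz X (p.1, p.1 / ε, p.2 / ε) := by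
    rw [pdz, ← smul_eq_mul, ← map_smul]
    simp
  rw [htot.fderiv]
  simp only [_root_.add_apply, _root_.neg_apply, _root_.smul_apply, smul_eq_mul,
    ContinuousLinearMap.comp_apply, ContinuousLinearMap.prod_apply, ContinuousLinearMap.coe_fst',
    ContinuousLinearMap.coe_snd', mul_one, mul_zero, l1, l2, hd1]
  constructor <;> field_simp <;> ring

lemma aux_split (β : ℝ → ℝ) (hβ : Continuous β) (γ : ℝ → ℝ) (hγ : Continuous γ)
    (k0 k1 k2 : ℝ × ℝ → ℝ) (h0 : Continuous k0) (h1 : Continuous k1) (h2 : Continuous k2)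
    (ε : ℝ) :
    ∫ x in (0:ℝ)..1, ∫ z in (β x)..(γ x), (k0 (x, z) + ε * k1 (x, z) + ε ^ 2 * k2 (x, z))
      = (∫ x in (0:ℝ)..1, ∫ z in (β x)..(γ x), k0 (x, z))
        + ε * (∫ x in (0:ℝ)..1, ∫ z in (β x)..(γ x), k1 (x, z))
        + ε ^ 2 * (∫ x in (0:ℝ)..1, ∫ z in (β x)..(γ x), k2 (x, z)) := by
  have hi : ∀ k : ℝ × ℝ → ℝ, Continuous k → Continuous fun x => ∫ z in (β x)..(γ x), k (x, z) :=
    fun k hk => aux_paramint β γ hβ hγ (fun x z => k (x, z)) hk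
  have hj : ∀ k : ℝ × ℝ → ℝ, Continuous k → ∀ x u v,
      IntervalIntegrable (fun z => k (x, z)) volume u v := fun k hk x u v =>
    (hk.comp (Continuous.prodMk_right x)).intervalIntegrable u v
  have e : ∀ x, ∫ z in (β x)..(γ x), (k0 (x, z) + ε * k1 (x, z) + ε ^ 2 * k2 (x, z))
      = (∫ z in (β x)..(γ x), k0 (x, z)) + ε * (∫ z in (β x)..(γ x), k1 (x, z))
        + ε ^ 2 * (∫ z in (β x)..(γ x), k2 (x, z)) := by
    intro x
    rw [intervalIntegral.integral_add, intervalIntegral.integral_add,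
      intervalIntegral.integral_const_mul, intervalIntegral.integral_const_mul]
    · exact hj k0 h0 x _ _
    · exact (hj k1 h1 x _ _).const_mul ε
    · exact (hj k0 h0 x _ _).add ((hj k1 h1 x _ _).const_mul ε)
    · exact (hj k2 h2 x _ _).const_mul _
  simp only [e]
  have i0 := (hi k0 h0).intervalIntegrable (μ := volume) 0 1
  have i1 := ((hi k1 h1).intervalIntegrable (μ := volume) 0 1).const_mul ε
  have i2 := ((hi k2 h2).intervalIntegrable (μ := volume) 0 1).const_mul (ε ^ 2)
  rw [intervalIntegral.integral_add (i0.add i1) i2, intervalIntegral.integral_add i0 i1,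
      intervalIntegral.integral_const_mul, intervalIntegral.integral_const_mul]

lemma aux_w (w₀ : ℝ → ℝ) (hw₀ : ContDiffOn ℝ 2 w₀ (Icc 0 1)) :
    ∃ W W1 W2 : ℝ → ℝ, Continuous W ∧ Continuous W1 ∧ Continuous W2 ∧
      ∀ x ∈ Ioo (0:ℝ) 1, w₀ x = W x ∧ HasDerivAt w₀ (W1 x) x ∧ HasDerivAt (deriv w₀) (W2 x) x := by
  have hu : UniqueDiffOn ℝ (Icc (0:ℝ) 1) := uniqueDiffOn_Icc zero_lt_one
  have h1 : ContDiffOn ℝ 1 (derivWithin w₀ (Icc 0 1)) (Icc 0 1) := hw₀.derivWithin hu (by norm_num)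
  have h2 : ContinuousOn (derivWithin (derivWithin w₀ (Icc 0 1)) (Icc 0 1)) (Icc 0 1) :=
    h1.continuousOn_derivWithin hu le_rfl
  have hz : (0:ℝ) ≤ 1 := zero_le_one
  refine ⟨IccExtend hz ((Icc 0 1).domRestrict w₀),
    IccExtend hz ((Icc 0 1).domRestrict (derivWithin w₀ (Icc 0 1))),
    IccExtend hz ((Icc 0 1).domRestrict (derivWithin (derivWithin w₀ (Icc 0 1)) (Icc 0 1))),
    hw₀.continuousOn.domRestrict.Icc_extend', h1.continuousOn.domRestrict.Icc_extend',
    h2.domRestrict.Icc_extend', ?_⟩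
  intro x hx
  have hx' := Ioo_subset_Icc_self hx
  have hn : Icc (0:ℝ) 1 ∈ nhds x := Icc_mem_nhds hx.1 hx.2
  rw [IccExtend_of_mem _ _ hx', IccExtend_of_mem _ _ hx', IccExtend_of_mem _ _ hx']
  refine ⟨rfl, ?_, ?_⟩
  · exact ((hw₀.differentiableOn two_ne_zero x hx').hasDerivWithinAt).hasDerivAt hn
  · have := ((h1.differentiableOn one_ne_zero x hx').hasDerivWithinAt).hasDerivAt hn
    refine this.congr_of_eventuallyEq ?_
    filter_upwards [Ioo_mem_nhds hx.1 hx.2] with y hy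
    exact (derivWithin_of_mem_nhds (Icc_mem_nhds hy.1 hy.2)).symm

/-- Convergence of the rescaled `H¹`-energy of `w₀ + κ^ε` on the thin domain to
the homogenized energy `∫₀¹ (r w₀'² + p w₀²)`. -/
theorem stmt_1 (L b₁ G₀ G₁ : ℝ) (hL : 0 < L) (hG₀ : 0 < G₀)
    (b : ℝ → ℝ) (hbc : ContinuousOn b (Icc 0 1)) (hbC1 : ContDiffOn ℝ 1 b (Ioo 0 1))
    (hbb : ∀ x ∈ Icc (0 : ℝ) 1, 0 ≤ b x ∧ b x ≤ b₁)
    (G : ℝ × ℝ → ℝ) (hGc : ContinuousOn G (Icc 0 1 ×ˢ (univ : Set ℝ)))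
    (hGC1 : ContDiffOn ℝ 1 G (Ioo 0 1 ×ˢ (univ : Set ℝ)))
    (hGper : ∀ x y : ℝ, G (x, y + L) = G (x, y))
    (hGb : ∀ x ∈ Icc (0 : ℝ) 1, ∀ y : ℝ, G₀ ≤ G (x, y) ∧ G (x, y) ≤ G₁)
    -- (ii) the map (x,y,z) ↦ X(x)(y,z) is C¹ with bounded first derivatives
    (X : ℝ × ℝ × ℝ → ℝ) (hXC1 : ContDiff ℝ 1 X)
    (hXbd : ∃ C : ℝ, ∀ q : ℝ × ℝ × ℝ, ‖fderiv ℝ X q‖ ≤ C)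
    -- for every x ∈ (0,1), X(x) is the cell solution on Y*(x):
    (hXharm : ∀ x ∈ Ioo (0 : ℝ) 1, ∀ q ∈ cellDomain L b G x,
      DifferentiableAt ℝ (pdy X) (x, q.1, q.2) ∧ DifferentiableAt ℝ (pdz X) (x, q.1, q.2) ∧
      fderiv ℝ (pdy X) (x, q.1, q.2) (0, 1, 0) + fderiv ℝ (pdz X) (x, q.1, q.2) (0, 0, 1) = 0)
    (hXupper : ∀ x ∈ Ioo (0 : ℝ) 1, ∀ y : ℝ,
      pdz X (x, y, G (x, y)) - fderiv ℝ G (x, y) (0, 1) * pdy X (x, y, G (x, y))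
        = -(fderiv ℝ G (x, y) (0, 1)))
    (hXlower : ∀ x ∈ Ioo (0 : ℝ) 1, ∀ y : ℝ, pdz X (x, y, -(b x)) = 0)
    (hXper : ∀ x ∈ Ioo (0 : ℝ) 1, ∀ y z : ℝ, X (x, y + L, z) = X (x, y, z))
    (hXmean : ∀ x ∈ Ioo (0 : ℝ) 1, ∫ q in cellDomain L b G x, X (x, q.1, q.2) = 0)
    -- w₀ ∈ C²([0,1])
    (w₀ : ℝ → ℝ) (hw₀ : ContDiffOn ℝ 2 w₀ (Icc 0 1)) :
    Tendsto (fun ε : ℝ => ε⁻¹ * ∫ p in thinDomain b G ε,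
        ((fderiv ℝ (fun q : ℝ × ℝ => w₀ q.1 + corrector X w₀ ε q) p (1, 0)) ^ 2
          + (fderiv ℝ (fun q : ℝ × ℝ => w₀ q.1 + corrector X w₀ ε q) p (0, 1)) ^ 2
          + (w₀ p.1 + corrector X w₀ ε p) ^ 2))
      (nhdsWithin 0 (Ioi 0))
      (nhds (∫ x in Ioo (0 : ℝ) 1,
        (rcoef L b G X x * deriv w₀ x ^ 2 + pcoef L b G x * w₀ x ^ 2))) := by
  obtain ⟨W, W1, W2, hW, hW1, hW2, hWs⟩ := aux_w w₀ hw₀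
  have hX : Continuous X := hXC1.continuous
  have hX' : Continuous (fderiv ℝ X) := hXC1.continuous_fderiv one_ne_zero
  have hpy : Continuous (pdy X) := by unfold pdy; fun_prop
  have hpz : Continuous (pdz X) := by unfold pdz; fun_prop
  let c : ℝ → ℝ := fun x => max 0 (min 1 x)
  have hc : Continuous c := by simp only [c]; fun_prop
  have hcm : ∀ x, c x ∈ Icc (0:ℝ) 1 := fun x => ⟨le_max_left _ _, max_le zero_le_one (min_le_left _ _)⟩
  have hcx : ∀ x ∈ Icc (0:ℝ) 1, c x = x := fun x hx => by
    simp only [c]; rw [min_eq_right hx.2, max_eq_right hx.1]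
  let β : ℝ → ℝ := fun x => b (c x)
  let Γ : ℝ × ℝ → ℝ := fun q => G (c q.1, q.2)
  have hβ : Continuous β := hbc.comp_continuous hc hcm
  have hΓ : Continuous Γ := hGc.comp_continuous (by fun_prop : Continuous fun q : ℝ × ℝ => (c q.1, q.2))
    (fun q => ⟨hcm q.1, mem_univ _⟩)
  have hΓp : ∀ x y, Γ (x, y + L) = Γ (x, y) := fun x y => hGper _ _
  have hβΓ : ∀ x y, -(β x) < Γ (x, y) := fun x y => by
    have h1 := (hbb _ (hcm x)).1
    have h2 := (hGb _ (hcm x) y).1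
    simp only [β, Γ]; linarith
  have hfp := aux_fper L X hXC1 hXper
  -- building blocks
  let ξ : ℝ × ℝ × ℝ → ℝ × ℝ × ℝ := fun q => (c q.1, q.2.1, q.2.2)
  have hξ : Continuous ξ := by simp only [ξ]; fun_prop
  let A : ℝ × ℝ × ℝ → ℝ := fun q => W1 q.1 * (1 - pdy X (ξ q))
  let B : ℝ × ℝ × ℝ → ℝ := fun q => pdz X (ξ q) * W1 q.1
  let E : ℝ × ℝ × ℝ → ℝ := fun q => fderiv ℝ X (ξ q) (1, 0, 0) * W1 q.1 + X (ξ q) * W2 q.1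
  let V : ℝ × ℝ × ℝ → ℝ := fun q => X (ξ q) * W1 q.1
  have hA : Continuous A := by simp only [A]; fun_prop
  have hB : Continuous B := by simp only [B]; fun_prop
  have hE : Continuous E := by simp only [E]; fun_prop
  have hV : Continuous V := by simp only [V]; fun_prop
  have hξX : ∀ x y z, X (ξ (x, y + L, z)) = X (ξ (x, y, z)) := fun x y z => (hfp _ (hcm x) y z).1
  have hξX' : ∀ x y z, fderiv ℝ X (ξ (x, y + L, z)) = fderiv ℝ X (ξ (x, y, z)) :=
    fun x y z => (hfp _ (hcm x) y z).2
  have hAp : ∀ x y z, A (x, y + L, z) = A (x, y, z) := fun x y z => by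
    simp only [A, pdy, hξX']
  have hBp : ∀ x y z, B (x, y + L, z) = B (x, y, z) := fun x y z => by
    simp only [B, pdz, hξX']
  have hEp : ∀ x y z, E (x, y + L, z) = E (x, y, z) := fun x y z => by
    simp only [E, hξX, hξX']
  have hVp : ∀ x y z, V (x, y + L, z) = V (x, y, z) := fun x y z => by
    simp only [V, hξX]
  let h0 : ℝ × ℝ × ℝ → ℝ := fun q => A q ^ 2 + B q ^ 2 + W q.1 ^ 2
  let h1 : ℝ × ℝ × ℝ → ℝ := fun q => -2 * (A q * E q + W q.1 * V q)
  let h2 : ℝ × ℝ × ℝ → ℝ := fun q => E q ^ 2 + V q ^ 2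
  have ch0 : Continuous h0 := by simp only [h0]; fun_prop
  have ch1 : Continuous h1 := by simp only [h1]; fun_prop
  have ch2 : Continuous h2 := by simp only [h2]; fun_prop
  have t0 := aux_hom L hL β hβ Γ hΓ hΓp h0 ch0 (fun x y z => by simp only [h0, hAp, hBp])
  have t1 := aux_hom L hL β hβ Γ hΓ hΓp h1 ch1 (fun x y z => by simp only [h1, hAp, hEp, hVp])
  have t2 := aux_hom L hL β hβ Γ hΓ hΓp h2 ch2 (fun x y z => by simp only [h2, hEp, hVp])
  have tε : Tendsto (fun ε : ℝ => ε) (nhdsWithin 0 (Ioi 0)) (nhds 0) :=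
    tendsto_nhdsWithin_of_tendsto_nhds tendsto_id
  have tt := (t0.add (tε.mul t1)).add ((tε.pow 2).mul t2)
  -- identification of the limit
  have hlim : ∫ x in Ioo (0 : ℝ) 1, (rcoef L b G X x * deriv w₀ x ^ 2 + pcoef L b G x * w₀ x ^ 2)
      = ∫ x in (0:ℝ)..1, (1 / L) * ∫ y in (0:ℝ)..L, ∫ z in (-(β x))..(Γ (x, y)), h0 (x, y, z) := by
    rw [intervalIntegral.integral_of_le zero_le_one, integral_Ioc_eq_integral_Ioo]
    refine setIntegral_congr_fun measurableSet_Ioo ?_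
    intro x hx
    have hxc := hcx x (Ioo_subset_Icc_self hx)
    obtain ⟨hw, hw1, hw2⟩ := hWs x hx
    have hβx : β x = b x := by simp only [β, hxc]
    have hΓx : ∀ y, Γ (x, y) = G (x, y) := fun y => by simp only [Γ, hxc]
    have hbG : ∀ y, -(b x) < G (x, y) := fun y => by rw [← hβx, ← hΓx]; exact hβΓ x y
    have hGx : Continuous fun y => G (x, y) := by
      have : Continuous fun y => Γ (x, y) := by fun_prop
      simpa only [hΓx] using this
    have hen := aux_energy L hL b G hGC1 hGper X hXC1 hXper x hx hbG (hXharm x hx) (hXupper x hx)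
      (hXlower x hx)
    have hr : ∫ q in cellDomain L b G x, (1 - pdy X (x, q.1, q.2))
        = ∫ y in (0:ℝ)..L, ∫ z in (-(b x))..(G (x, y)), (1 - pdy X (x, y, z)) :=
      aux_region L hL.le (fun _ => -(b x)) (fun y => G (x, y)) continuous_const hGx
        (fun y => (hbG y).le) (fun q => 1 - pdy X (x, q.1, q.2)) (by fun_prop)
    have hp : (volume (cellDomain L b G x)).toReal
        = ∫ y in (0:ℝ)..L, ∫ z in (-(b x))..(G (x, y)), (1:ℝ) := by
      rw [← aux_region L hL.le (fun _ => -(b x)) (fun y => G (x, y)) continuous_const hGx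
        (fun y => (hbG y).le) (fun _ => (1:ℝ)) continuous_const]
      rw [setIntegral_const, smul_eq_mul, mul_one]
      rfl
    have hii : ∀ (f : ℝ × ℝ → ℝ), Continuous f →
        Continuous fun y => ∫ z in (-(b x))..(G (x, y)), f (y, z) := by
      intro f hf
      exact aux_paramint (fun _ : ℝ => -(b x)) (fun y => G (x, y)) (by fun_prop) hGx
        (fun y z => f (y, z)) (by simp only [Function.uncurry_def]; fun_prop)
    have hcE : Continuous fun q : ℝ × ℝ => (1 - pdy X (x, q.1, q.2)) ^ 2 + pdz X (x, q.1, q.2) ^ 2 := by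
      fun_prop
    have hsplit : ∫ y in (0:ℝ)..L, ∫ z in (-(β x))..(Γ (x, y)), h0 (x, y, z)
        = W1 x ^ 2 * (∫ y in (0:ℝ)..L, ∫ z in (-(b x))..(G (x, y)),
          ((1 - pdy X (x, y, z)) ^ 2 + pdz X (x, y, z) ^ 2))
          + W x ^ 2 * ∫ y in (0:ℝ)..L, ∫ z in (-(b x))..(G (x, y)), (1:ℝ) := by
      rw [← intervalIntegral.integral_const_mul, ← intervalIntegral.integral_const_mul,
        ← intervalIntegral.integral_add]
      · congr 1
        ext y
        rw [← intervalIntegral.integral_const_mul, ← intervalIntegral.integral_const_mul,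
          ← intervalIntegral.integral_add, hβx, hΓx]
        · congr 1
          ext z
          simp only [h0, A, B, ξ, hxc]
          ring
        · apply Continuous.intervalIntegrable; fun_prop
        · exact intervalIntegrable_const
      · exact ((hii _ hcE).intervalIntegrable _ _).const_mul _
      · exact ((hii (fun _ => 1) continuous_const).intervalIntegrable _ _).const_mul _
    simp only
    rw [hsplit, hen, rcoef, pcoef, hr, hp, hw, hw1.deriv]
    ring
  rw [hlim]
  have hzero : ∀ m0 m1 m2 : ℝ, m0 + 0 * m1 + 0 ^ 2 * m2 = m0 := fun m0 m1 m2 => by ring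
  rw [hzero] at tt
  refine tt.congr' ?_
  filter_upwards [self_mem_nhdsWithin] with ε hε
  have hε : 0 < ε := hε
  have hdom : thinDomain b G ε = {p : ℝ × ℝ | p.1 ∈ Ioo 0 1 ∧
      p.2 ∈ Ioo (ε * (-(β p.1))) (ε * Γ (p.1, p.1 / ε))} := by
    ext p
    simp only [thinDomain, mem_ofPred_eq]
    refine and_congr_right fun hp => ?_
    simp only [β, Γ, hcx _ (Ioo_subset_Icc_self hp), mul_neg]
  have hγε : Continuous fun x => Γ (x, x / ε) := by fun_prop
  have hmeas : MeasurableSet (thinDomain b G ε) := by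
    rw [hdom]
    exact measurableSet_regionBetween (f := fun x => ε * (-(β x)))
      (g := fun x => ε * Γ (x, x / ε)) (by fun_prop) (by fun_prop) measurableSet_Ioo
  let K : ℝ × ℝ → ℝ := fun p => h0 (p.1, p.1 / ε, p.2 / ε) + ε * h1 (p.1, p.1 / ε, p.2 / ε)
    + ε ^ 2 * h2 (p.1, p.1 / ε, p.2 / ε)
  have hK : Continuous K := by simp only [K]; fun_prop
  have hcongr : ∫ p in thinDomain b G ε,
        ((fderiv ℝ (fun q : ℝ × ℝ => w₀ q.1 + corrector X w₀ ε q) p (1, 0)) ^ 2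
          + (fderiv ℝ (fun q : ℝ × ℝ => w₀ q.1 + corrector X w₀ ε q) p (0, 1)) ^ 2
          + (w₀ p.1 + corrector X w₀ ε p) ^ 2) = ∫ p in thinDomain b G ε, K p := by
    refine setIntegral_congr_fun hmeas ?_
    intro p hp
    have hp1 : p.1 ∈ Ioo (0:ℝ) 1 := hp.1
    obtain ⟨hw, hw1, hw2⟩ := hWs p.1 hp1
    obtain ⟨g1, g2⟩ := aux_grad X hXC1 w₀ ε hε p _ _ hw1 hw2
    simp only [g1, g2]
    simp only [corrector, hw1.deriv, hw, K, h0, h1, h2, A, B, E, V, ξ,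
      hcx _ (Ioo_subset_Icc_self hp1)]
    ring
  rw [hcongr, hdom, aux_region 1 zero_le_one (fun x => ε * (-(β x))) (fun x => ε * Γ (x, x / ε))
    (by fun_prop) (by fun_prop)
    (fun x => mul_le_mul_of_nonneg_left (hβΓ x _).le hε.le) K hK]
  have hsp := aux_split (fun x => -(β x)) (by fun_prop)
    (fun x => Γ (x, x / ε)) hγε (fun p => h0 (p.1, p.1 / ε, p.2)) (fun p => h1 (p.1, p.1 / ε, p.2))
    (fun p => h2 (p.1, p.1 / ε, p.2)) (by fun_prop) (by fun_prop) (by fun_prop) ε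
  refine hsp.symm.trans ?_
  refine Eq.trans ?_ (intervalIntegral.integral_const_mul _ _)
  congr 1
  ext x
  have := intervalIntegral.integral_comp_mul_left (a := -(β x)) (b := Γ (x, x / ε))
    (fun z => K (x, z)) hε.ne'
  rw [smul_eq_mul] at this
  rw [← this]
  congr 1
  ext z
  simp only [K, mul_div_cancel_left₀ _ hε.ne']
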